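/- A symmetric rank-one convex, positively 1-homogeneous function f on the space of symmetric deviatoric d×d matrices admits, at each point of the form a⊙b with a ⊥ b, a supporting linear functional: there exists a linear ℓ with ℓ(a⊙b) = f(a⊙b) and f ≥ ℓ everywhere. -/

import Mathlib

open Matrix

/-- Symmetrized tensor product `a ⊙ b := (a bᵀ + b aᵀ)/2`. -/
noncomputable def sprod {d : ℕ} (a b : Fin d → ℝ) : Matrix (Fin d) (Fin d) ℝ :=
  Matrix.of fun i j => (a i * b j + b i * a j) / 2

namespace KK

variable {V : Type*} [AddCommGroup V] [Module ℝ V]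

/-- Positively 1-homogeneous and convex in the directions of `D`. -/
structure Good (D : Set V) (f : V → ℝ) : Prop where
  hom : ∀ α : ℝ, 0 ≤ α → ∀ x, f (α • x) = α * f x
  conv : ∀ e ∈ D, ∀ x, ConvexOn ℝ Set.univ (fun t : ℝ => f (x + t • e))

/-- `f` is affine in the direction `z`. -/
def Lin (f : V → ℝ) (z : V) : Prop := ∀ x (s : ℝ), f (x + s • z) = f x + s * f z

lemma Good.zero {D : Set V} {f : V → ℝ} (h : Good D f) : f 0 = 0 := by
  have := h.hom 0 le_rfl 0
  simpa using this

lemma convex_le_max {φ : ℝ → ℝ} (h : ConvexOn ℝ Set.univ φ) {t : ℝ} (ht : |t| ≤ 1) :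
    φ t ≤ max (φ (-1)) (φ 1) := by
  obtain ⟨h1, h2⟩ := abs_le.1 ht
  refine h.le_max_of_mem_Icc (Set.mem_univ _) (Set.mem_univ _) ⟨h1, h2⟩

/-- convex with linear upper bound on the right: slope bound -/
lemma convex_slope {φ : ℝ → ℝ} (h : ConvexOn ℝ Set.univ φ) {A B : ℝ}
    (hb : ∀ t, 0 ≤ t → φ t ≤ A + B * t) {a s : ℝ} (hs : 0 ≤ s) :
    φ (a + s) ≤ φ a + B * s := by
  by_contra hc
  push Not at hc
  have hs0 : 0 < s := by
    rcases hs.eq_or_lt with h0 | h0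
    · subst h0; simp at hc
    · exact h0
  set δ := φ (a + s) - φ a - B * s with hδ
  have hδ0 : 0 < δ := by linarith
  -- for t large, φ (a + t) ≥ φ a + (t / s) (φ (a+s) - φ a)
  have key : ∀ t, s < t → φ a + t / s * (B * s + δ) ≤ φ (a + t) := by
    intro t ht
    have ht0 : 0 < t := hs0.trans ht
    have q1 : 0 ≤ 1 - s / t := by rw [sub_nonneg, div_le_one ht0]; exact ht.le
    have q2 : 0 ≤ s / t := by positivity
    have h2 := h.2 (Set.mem_univ a) (Set.mem_univ (a + t)) q1 q2 (by ring)
    have e1 : (1 - s / t) • a + (s / t) • (a + t) = a + s := by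
      simp only [smul_eq_mul]; field_simp; ring
    rw [e1] at h2
    simp only [smul_eq_mul] at h2
    have h3 : φ (a + s) - φ a = B * s + δ := by rw [hδ]; ring
    have h4 : B * s + δ ≤ s / t * (φ (a + t) - φ a) := by
      rw [← h3]; linarith
    have h5 := mul_le_mul_of_nonneg_left h4 (by positivity : 0 ≤ t / s)
    have h6 : t / s * (s / t * (φ (a + t) - φ a)) = φ (a + t) - φ a := by
      field_simp
    linarith
  set T := max (s + 1) (max (-a) ((A + B * a - φ a) * s / δ + 1)) with hT
  have hT1 : s + 1 ≤ T := le_max_left _ _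
  have hT2 : -a ≤ T := (le_max_left _ _).trans (le_max_right _ _)
  have hT3 : (A + B * a - φ a) * s / δ + 1 ≤ T := (le_max_right _ _).trans (le_max_right _ _)
  have k1 := key T (by linarith)
  have k2 := hb (a + T) (by linarith)
  have k3 : T / s * (B * s + δ) = B * T + T * δ / s := by field_simp
  have k4 : T * δ / s ≤ A + B * a - φ a := by linarith
  rw [div_le_iff₀ hs0] at k4
  have k5 : T ≤ (A + B * a - φ a) * s / δ := by rw [le_div_iff₀ hδ0]; exact k4
  linarith

lemma cube {D : Set V} {f : V → ℝ} (h : Good D f) {ι : Type*} [DecidableEq ι] (x : ι → V)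
    (hx : ∀ i, x i ∈ D) (s : Finset ι) : ∀ y, ∃ M, ∀ c : ι → ℝ, (∀ i, |c i| ≤ 1) →
      f (y + ∑ i ∈ s, c i • x i) ≤ M := by
  induction s using Finset.induction_on with
  | empty => intro y; exact ⟨f y, by simp⟩
  | insert i s his ih =>
    intro y
    obtain ⟨M1, h1⟩ := ih (y + (-1 : ℝ) • x i)
    obtain ⟨M2, h2⟩ := ih (y + (1 : ℝ) • x i)
    refine ⟨max M1 M2, fun c hc => ?_⟩
    rw [Finset.sum_insert his]
    have := convex_le_max (h.conv (x i) (hx i) (y + ∑ j ∈ s, c j • x j)) (hc i)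
    have h1 := h1 c hc
    have h2 := h2 c hc
    rw [add_right_comm] at h1 h2
    calc _ = f (y + ∑ j ∈ s, c j • x j + c i • x i) := by congr 1; abel
      _ ≤ _ := this
      _ ≤ _ := max_le_max h1 h2

lemma growth {D : Set V} {f : V → ℝ} (h : Good D f) {ι : Type*} [Fintype ι] [DecidableEq ι]
    (x : ι → V) (hx : ∀ i, x i ∈ D) :
    ∃ M, 0 ≤ M ∧ ∀ c : ι → ℝ, f (∑ i, c i • x i) ≤ M * ∑ i, |c i| := by
  obtain ⟨M, hM⟩ := cube h x hx Finset.univ 0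
  have hM0 : 0 ≤ M := by simpa [h.zero] using hM 0 (by simp)
  refine ⟨M, hM0, fun c => ?_⟩
  set N := ∑ i, |c i| with hN
  have hle : ∀ i, |c i| ≤ N := fun i =>
    Finset.single_le_sum (f := fun i => |c i|) (fun _ _ => abs_nonneg _) (Finset.mem_univ i)
  have hN0 : 0 ≤ N := Finset.sum_nonneg (fun _ _ => abs_nonneg _)
  rcases hN0.eq_or_lt with h0 | h0
  · have : ∀ i, c i = 0 := fun i => abs_eq_zero.1 (le_antisymm (h0 ▸ hle i) (abs_nonneg _))
    simp [this, h.zero, ← h0]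
  · have := hM (fun i => c i / N) (fun i => by
      rw [abs_div, abs_of_pos h0, div_le_one h0]; exact hle i)
    have e : ∑ i, c i • x i = N • ∑ i, (c i / N) • x i := by
      rw [Finset.smul_sum]
      refine Finset.sum_congr rfl fun i _ => ?_
      rw [smul_smul]; congr 1; field_simp
    rw [zero_add] at this
    rw [e, h.hom N hN0, mul_comm M]
    exact mul_le_mul_of_nonneg_left this hN0

lemma lip {D : Set V} {f : V → ℝ} (h : Good D f) {ι : Type*} [Fintype ι] [DecidableEq ι]
    (x : ι → V) (hx : ∀ i, x i ∈ D) (hspan : Submodule.span ℝ (Set.range x) = ⊤) (z : V) :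
    ∃ C, ∀ y, f (y + z) ≤ f y + C := by
  obtain ⟨M, hM0, hM⟩ := growth h x hx
  have rep : ∀ v : V, ∃ c : ι → ℝ, ∑ i, c i • x i = v := fun v =>
    (Submodule.mem_span_range_iff_exists_fun ℝ).1 (hspan ▸ Submodule.mem_top)
  -- one direction
  have one : ∀ i (σ : ℝ), |σ| = 1 → ∀ y s, 0 ≤ s → f (y + (σ * s) • x i) ≤ f y + M * s := by
    intro i σ hσ y s hs
    obtain ⟨c, rfl⟩ := rep y
    have hcv : ConvexOn ℝ Set.univ (fun t : ℝ => f (∑ j, c j • x j + (σ * t) • x i)) := by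
      refine ⟨convex_univ, fun p _ q _ a b ha hb hab => ?_⟩
      have := (h.conv (x i) (hx i) (∑ j, c j • x j)).2 (Set.mem_univ (σ * p))
        (Set.mem_univ (σ * q)) ha hb hab
      simp only [smul_eq_mul] at this ⊢
      convert this using 4
      ring
    have := convex_slope hcv (A := M * ∑ j, |c j|) (B := M) (fun t ht => by
      have e : ∑ j, c j • x j + (σ * t) • x i
          = ∑ j, (c j + if j = i then σ * t else 0) • x j := by
        simp [add_smul, Finset.sum_add_distrib, ite_smul]
      simp only [e]
      refine (hM _).trans ?_
      rw [← mul_add]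
      refine mul_le_mul_of_nonneg_left ?_ hM0
      calc ∑ j, |c j + if j = i then σ * t else 0|
          ≤ ∑ j, (|c j| + |if j = i then σ * t else 0|) :=
            Finset.sum_le_sum fun j _ => abs_add_le _ _
        _ = _ := by
          rw [Finset.sum_add_distrib]
          congr 1
          rw [Finset.sum_eq_single i]
          · simp [abs_mul, hσ, abs_of_nonneg ht]
          · intro b _ hb; simp [hb]
          · simp) (a := 0) hs
    simpa using this
  have one' : ∀ i y s, f (y + s • x i) ≤ f y + M * |s| := by
    intro i y s
    rcases le_total 0 s with hs | hs
    · simpa [abs_of_nonneg hs] using one i 1 (by simp) y s hs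
    · simpa [abs_of_nonpos hs] using one i (-1) (by simp) y (-s) (by linarith)
  obtain ⟨c, rfl⟩ := rep z
  have : ∀ s : Finset ι, ∀ y, f (y + ∑ i ∈ s, c i • x i) ≤ f y + ∑ i ∈ s, M * |c i| := by
    intro s
    induction s using Finset.induction_on with
    | empty => simp
    | insert i s his ih =>
      intro y
      rw [Finset.sum_insert his, Finset.sum_insert his, ← add_assoc]
      have := ih (y + c i • x i)
      have := one' i y (c i)
      linarith
  exact ⟨_, this Finset.univ⟩

open Filter Topology

lemma step {D : Set V} {f : V → ℝ} (h : Good D f)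
    (hlip : ∀ z, ∃ C, ∀ y, f (y + z) ≤ f y + C) {e : V} (he : e ∈ D) :
    ∃ g, Good D g ∧ (∀ x, g x ≤ f x) ∧ Lin g e ∧ g e = f e ∧
      ∀ z, Lin f z → Lin g z ∧ g z = f z := by
  have mono : ∀ x, ∃ l, Tendsto (fun t : ℝ => f (x + t • e) - t * f e) atTop (𝓝 l) ∧
      l ≤ f x := by
    intro x
    obtain ⟨C, hC⟩ := hlip x
    obtain ⟨C', hC'⟩ := hlip (-x)
    have ub : ∀ t, 0 ≤ t → f (x + t • e) ≤ C + f e * t := fun t ht => by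
      have := hC (t • e)
      rw [h.hom t ht, add_comm (t • e)] at this
      linarith
    have lb : ∀ t, 0 ≤ t → -C' ≤ f (x + t • e) - t * f e := fun t ht => by
      have := hC' (x + t • e)
      rw [show x + t • e + -x = t • e by abel, h.hom t ht] at this
      linarith
    have hanti : Antitone (fun t : ℝ => f (x + t • e) - t * f e) := by
      intro a b hab
      have := convex_slope (h.conv e he x) ub (a := a) (sub_nonneg.2 hab)
      simp only [add_sub_cancel] at this
      simp only
      linarith
    have hbdd : BddBelow (Set.range (fun t : ℝ => f (x + t • e) - t * f e)) := by
      refine ⟨-C', ?_⟩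
      rintro _ ⟨t, rfl⟩
      exact (lb (max t 0) (le_max_right _ _)).trans (hanti (le_max_left _ _))
    refine ⟨_, tendsto_atTop_ciInf hanti hbdd, ?_⟩
    simpa using ciInf_le hbdd 0
  choose g hg hgf using mono
  have hg0 : g 0 = 0 := by
    refine tendsto_nhds_unique (hg 0) (tendsto_const_nhds.congr' ?_)
    filter_upwards [eventually_ge_atTop 0] with t ht
    rw [zero_add, h.hom t ht]; ring
  have lin : ∀ z, Lin f z → ∀ x (s : ℝ), g (x + s • z) = g x + s * f z := by
    intro z hz x s
    refine tendsto_nhds_unique (hg _) (((hg x).add_const (s * f z)).congr fun t => ?_)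
    rw [add_right_comm, hz]; ring
  have line : ∀ x (s : ℝ), g (x + s • e) = g x + s * f e := by
    intro x s
    refine tendsto_nhds_unique (hg _) ((((hg x).comp
      (tendsto_atTop_add_const_right atTop s tendsto_id)).add_const (s * f e)).congr fun t => ?_)
    simp only [Function.comp, id]
    rw [show x + s • e + t • e = x + (t + s) • e by rw [add_smul]; abel]
    ring
  have val : ∀ z, (∀ x (s : ℝ), g (x + s • z) = g x + s * f z) → Lin g z ∧ g z = f z := by
    intro z hz
    have : g z = f z := by simpa [hg0] using hz 0 1
    exact ⟨fun x s => by rw [hz, this], this⟩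
  refine ⟨g, ⟨?_, ?_⟩, hgf, (val e line).1, (val e line).2, fun z hz => val z (lin z hz)⟩
  · intro α hα x
    rcases hα.eq_or_lt with h0 | h0
    · subst h0; simp [hg0]
    · refine tendsto_nhds_unique (hg _) ((((hg x).comp
        (tendsto_id.atTop_div_const h0)).const_mul α).congr fun t => ?_)
      simp only [Function.comp, id]
      have : α • x + t • e = α • (x + (t / α) • e) := by
        rw [smul_add, smul_smul]; congr 2; field_simp
      rw [this, h.hom α hα]; field_simp
  · intro c hc x
    refine ⟨convex_univ, fun p _ q _ a b ha hb hab => ?_⟩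
    refine le_of_tendsto_of_tendsto' (hg _)
      (((hg (x + p • c)).const_mul a).add ((hg (x + q • c)).const_mul b)) fun t => ?_
    have := (h.conv c hc (x + t • e)).2 (Set.mem_univ p) (Set.mem_univ q) ha hb hab
    simp only [smul_eq_mul] at this ⊢
    rw [add_right_comm x _ (t • e), add_right_comm x _ (t • e), add_right_comm x _ (t • e)]
    have e2 : t * f e = a * (t * f e) + b * (t * f e) := by rw [← add_mul, hab, one_mul]
    linarith

theorem main {D : Set V} {f : V → ℝ} (h : Good D f) {ι : Type*} [Fintype ι] [DecidableEq ι]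
    (x : ι → V) (hx : ∀ i, x i ∈ D) (hspan : Submodule.span ℝ (Set.range x) = ⊤)
    {e : V} (he : e ∈ D) : ∃ l : V →ₗ[ℝ] ℝ, l e = f e ∧ ∀ v, l v ≤ f v := by
  obtain ⟨g, hg, hgf, hge, hgv, -⟩ := step h (lip h x hx hspan) he
  have iter : ∀ s : Finset ι, ∃ k, Good D k ∧ (∀ v, k v ≤ g v) ∧ (k e = g e ∧ Lin k e) ∧
      ∀ i ∈ s, Lin k (x i) := by
    intro s
    induction s using Finset.induction_on with
    | empty => exact ⟨g, hg, fun _ => le_rfl, ⟨rfl, hge⟩, by simp⟩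
    | insert i s his ih =>
      obtain ⟨k, hk, hkg, ⟨hke, hkl⟩, hks⟩ := ih
      obtain ⟨m, hm, hmk, hmi, -, hml⟩ := step hk (lip hk x hx hspan) (hx i)
      refine ⟨m, hm, fun v => (hmk v).trans (hkg v),
        ⟨(hml e hkl).2.trans hke, (hml e hkl).1⟩, fun j hj => ?_⟩
      rcases Finset.mem_insert.1 hj with rfl | hj
      · exact hmi
      · exact (hml _ (hks j hj)).1
  obtain ⟨k, hk, hkg, ⟨hke, -⟩, hks⟩ := iter Finset.univ
  have all : ∀ z, Lin k z := by
    intro z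
    have hz : z ∈ Submodule.span ℝ (Set.range x) := hspan ▸ Submodule.mem_top
    induction hz using Submodule.span_induction with
    | mem z hz => obtain ⟨i, rfl⟩ := hz; exact hks i (Finset.mem_univ i)
    | zero => intro y s; simp [hk.zero]
    | add p q _ _ hp hq =>
      have hpq : k (p + q) = k p + k q := by simpa using hq p 1
      intro y s
      rw [smul_add, ← add_assoc, hq, hp, hpq]; ring
    | smul a p _ hp =>
      have hap : k (a • p) = a * k p := by simpa [hk.zero] using hp 0 a
      intro y s
      rw [smul_smul, hp, hap]; ring
  refine ⟨{ toFun := k, map_add' := fun p q => by simpa using all q p 1,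
            map_smul' := fun a p => by simpa [hk.zero] using all p 0 a }, ?_, ?_⟩
  · exact hke.trans hgv
  · exact fun v => (hkg v).trans (hgf v)

/-- Symmetric trace-free matrices. -/
def SD (d : ℕ) : Submodule ℝ (Matrix (Fin d) (Fin d) ℝ) where
  carrier := {M | Mᵀ = M ∧ M.trace = 0}
  add_mem' := by
    rintro a b ⟨h1, h2⟩ ⟨h3, h4⟩
    exact ⟨by rw [Matrix.transpose_add, h1, h3], by rw [Matrix.trace_add, h2, h4, add_zero]⟩
  zero_mem' := by simp
  smul_mem' := by
    rintro c a ⟨h1, h2⟩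
    exact ⟨by rw [Matrix.transpose_smul, h1], by rw [Matrix.trace_smul, h2, smul_zero]⟩

lemma sprod_mem {d : ℕ} (a b : Fin d → ℝ) (h : a ⬝ᵥ b = 0) : sprod a b ∈ SD d := by
  refine ⟨?_, ?_⟩
  · ext i j; simp [sprod]; ring
  · have : (sprod a b).trace = a ⬝ᵥ b := by
      simp only [Matrix.trace, sprod, dotProduct, Matrix.diag, Matrix.of_apply]
      refine Finset.sum_congr rfl fun i _ => ?_
      ring
    rw [this, h]

/-- First factors of the spanning family. -/
noncomputable def fc {d : ℕ} (o : Fin d) (p : Fin d × Fin d) : Fin d → ℝ :=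
  if p.1 = p.2 then Pi.single p.1 1 + Pi.single o 1 else Pi.single p.1 1

/-- Second factors of the spanning family. -/
noncomputable def fe {d : ℕ} (o : Fin d) (p : Fin d × Fin d) : Fin d → ℝ :=
  if p.1 = p.2 then Pi.single p.1 1 - Pi.single o 1 else Pi.single p.2 1

lemma fc_fe {d : ℕ} (o : Fin d) (p : Fin d × Fin d) : fc o p ⬝ᵥ fe o p = 0 := by
  unfold fc fe
  split_ifs with h
  · simp only [add_dotProduct, dotProduct_sub, single_dotProduct, Pi.single_apply, Pi.sub_apply]
    by_cases h2 : p.1 = o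
    · simp [h2]
    · simp [h2, Ne.symm h2]
  · simp [Pi.single_apply, h]

lemma decomp {d : ℕ} (o : Fin d) (M : Matrix (Fin d) (Fin d) ℝ) (h1 : Mᵀ = M)
    (h2 : M.trace = 0) : ∑ p : Fin d × Fin d, M p.1 p.2 • sprod (fc o p) (fe o p) = M := by
  have key : ∀ p : Fin d × Fin d, sprod (fc o p) (fe o p) =
      sprod (Pi.single p.1 1) (Pi.single p.2 1)
        - (if p.1 = p.2 then (1 : ℝ) else 0) • sprod (Pi.single o 1) (Pi.single o 1) := by
    intro p
    unfold fc fe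
    split_ifs with h
    · ext i j; simp [sprod, ← h]; ring
    · simp
  have tr : ∑ p : Fin d × Fin d, M p.1 p.2 * (if p.1 = p.2 then (1 : ℝ) else 0) = 0 := by
    rw [Fintype.sum_prod_type]
    refine Eq.trans ?_ h2
    simp [Matrix.trace]
  simp only [key, smul_sub, Finset.sum_sub_distrib, smul_smul]
  rw [← Finset.sum_smul, tr, zero_smul, sub_zero]
  ext i j
  have hs : M j i = M i j := congrFun (congrFun h1 i) j
  rw [Matrix.sum_apply, Fintype.sum_prod_type]
  simp only [sprod, Matrix.smul_apply, Matrix.of_apply, smul_eq_mul, Pi.single_apply, add_div,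
    mul_add, Finset.sum_add_distrib]
  have a1 : ∑ x, ∑ y, M x y * ((if i = x then (1:ℝ) else 0) * (if j = y then 1 else 0) / 2)
      = M i j / 2 := by
    rw [Finset.sum_eq_single i, Finset.sum_eq_single j]
    · simp; ring
    · intro b _ hb; simp [Ne.symm hb]
    · simp
    · intro b _ hb; simp [Ne.symm hb]
    · simp
  have a2 : ∑ x, ∑ y, M x y * ((if i = y then (1:ℝ) else 0) * (if j = x then 1 else 0) / 2)
      = M j i / 2 := by
    rw [Finset.sum_eq_single j, Finset.sum_eq_single i]
    · simp; ring
    · intro b _ hb; simp [Ne.symm hb]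
    · simp
    · intro b _ hb; simp [Ne.symm hb]
    · simp
  rw [a1, a2, hs]; ring

end KK

/-- A symmetric rank-one convex, positively 1-homogeneous function on the
symmetric deviatoric matrices admits a supporting linear functional at every
point `a ⊙ b` with `a ⊥ b`. -/
theorem supporting_functional_at_orthogonal_sym_rank_one {d : ℕ} (hd : 2 ≤ d)
    (f : Matrix (Fin d) (Fin d) ℝ → ℝ)
    (hhom : ∀ α : ℝ, 0 ≤ α → ∀ M : Matrix (Fin d) (Fin d) ℝ, Mᵀ = M → M.trace = 0 →
      f (α • M) = α * f M)
    (hconv : ∀ c e : Fin d → ℝ, c ⬝ᵥ e = 0 →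
      ∀ M : Matrix (Fin d) (Fin d) ℝ, Mᵀ = M → M.trace = 0 →
        ConvexOn ℝ Set.univ (fun t : ℝ => f (M + t • sprod c e))) :
    ∀ a b : Fin d → ℝ, a ⬝ᵥ b = 0 →
      ∃ ℓ : Matrix (Fin d) (Fin d) ℝ →ₗ[ℝ] ℝ, ℓ (sprod a b) = f (sprod a b) ∧
        ∀ M : Matrix (Fin d) (Fin d) ℝ, Mᵀ = M → M.trace = 0 → ℓ M ≤ f M := by
  intro a b hab
  let o : Fin d := ⟨0, by omega⟩
  let D : Set (KK.SD d) := {v | ∃ c e : Fin d → ℝ, c ⬝ᵥ e = 0 ∧ (v : Matrix _ _ ℝ) = sprod c e}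
  have good : KK.Good D (fun v : KK.SD d => f v) := by
    refine ⟨fun α hα x => ?_, ?_⟩
    · simpa using hhom α hα x x.2.1 x.2.2
    · rintro ⟨e, he⟩ ⟨c, e', hce, h⟩ x
      simp only at h
      subst h
      simpa using hconv c e' hce x x.2.1 x.2.2
  let x : Fin d × Fin d → KK.SD d := fun p =>
    ⟨sprod (KK.fc o p) (KK.fe o p), KK.sprod_mem _ _ (KK.fc_fe o p)⟩
  have hspan : Submodule.span ℝ (Set.range x) = ⊤ := by
    rw [eq_top_iff]
    intro v _
    rw [Submodule.mem_span_range_iff_exists_fun]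
    refine ⟨fun p => (v : Matrix _ _ ℝ) p.1 p.2, ?_⟩
    apply Subtype.ext
    have := KK.decomp o v v.2.1 v.2.2
    simpa [x] using this
  obtain ⟨l, hl1, hl2⟩ := KK.main good x (fun p => ⟨_, _, KK.fc_fe o p, rfl⟩) hspan
    (e := ⟨sprod a b, KK.sprod_mem a b hab⟩) ⟨a, b, hab, rfl⟩
  obtain ⟨ℓ, hℓ⟩ := LinearMap.exists_extend l
  have hv : ∀ v : KK.SD d, ℓ v = l v := fun v => by rw [← hℓ]; rfl
  refine ⟨ℓ, ?_, fun M h1 h2 => ?_⟩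
  · rw [← hl1, ← hv]
  · have := hl2 ⟨M, h1, h2⟩
    rwa [← hv] at this
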